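/- arXiv:1612.02639 — 8 statements merged into one kernel-verified Lean document; each statement's English description precedes it below -/
import Mathlib

section
/- Let U be a simple K[G]-module and let u, u' ∈ U be nonzero elements. Then the left annihilators ann(u) = {x ∈ K[G] : x·u = 0} and ann(u') = {x ∈ K[G] : x·u' = 0} are equal if and only if there exists a nonzero scalar λ ∈ K with u' = λ·u. -/
/-- Let `U` be a simple `K[G]`-module and `u, u' ∈ U` nonzero. Then the left annihilators
`ann(u)` and `ann(u')` coincide iff `u' = λ • u` for some nonzero scalar `λ ∈ K`. -/
theorem annihilator_eq_iff_proportional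
    (K : Type*) [Field K] [IsAlgClosed K] [CharZero K]
    (G : Type*) [Group G] [Fintype G]
    (U : Type*) [AddCommGroup U] [Module K U] [Module (MonoidAlgebra K G) U]
    [IsScalarTower K (MonoidAlgebra K G) U]
    (hU : IsSimpleModule (MonoidAlgebra K G) U)
    (u u' : U) (hu : u ≠ 0) (hu' : u' ≠ 0) :
    {x : MonoidAlgebra K G | x • u = 0} = {x : MonoidAlgebra K G | x • u' = 0} ↔
      ∃ c : K, c ≠ 0 ∧ u' = c • u := by
  have hfin : Module.Finite K (MonoidAlgebra K G) :=
    Module.Finite.equiv (MonoidAlgebra.coeffLinearEquiv K).symm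
  have hsurj := IsSimpleModule.toSpanSingleton_surjective (MonoidAlgebra K G) hu
  have hU_fin : Module.Finite K U :=
    Module.Finite.of_surjective
      ((LinearMap.toSpanSingleton (MonoidAlgebra K G) U u).restrictScalars K) hsurj
  have hcomm (c : K) (x : MonoidAlgebra K G) (v : U) : x • c • v = c • x • v := by
    rw [← algebraMap_smul (MonoidAlgebra K G) c v, smul_smul, ← Algebra.commutes,
      ← smul_smul, algebraMap_smul]
  constructor
  · intro h
    have hker : LinearMap.ker (LinearMap.toSpanSingleton (MonoidAlgebra K G) U u) ≤
        LinearMap.ker (LinearMap.toSpanSingleton (MonoidAlgebra K G) U u') :=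
      fun x hx => (Set.ext_iff.mp h x).mp hx
    let f : Module.End (MonoidAlgebra K G) U :=
      (Submodule.liftQ _ _ hker).comp
        (LinearMap.quotKerEquivOfSurjective _ hsurj).symm.toLinearMap
    have hf : f u = u' := by
      have h_one : (LinearMap.quotKerEquivOfSurjective _ hsurj).symm u =
          Submodule.Quotient.mk 1 := by
        rw [LinearEquiv.symm_apply_eq]
        exact (one_smul _ u).symm
      change Submodule.liftQ _ _ hker ((LinearMap.quotKerEquivOfSurjective _ hsurj).symm u) = u'
      rw [h_one]
      exact one_smul _ u'
    obtain ⟨c, hc⟩ := (IsSimpleModule.algebraMap_end_bijective_of_isAlgClosed K).2 f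
    have huc : u' = c • u := by rw [← hf, ← hc]; rfl
    exact ⟨c, fun h0 => hu' (by rw [huc, h0, zero_smul]), huc⟩
  · rintro ⟨c, hc, rfl⟩
    ext x
    simp [hcomm, hc]
end

section
/- Let V be a simple K[G]-module of K-dimension n and let v_1, …, v_m ∈ V be K-linearly independent vectors (so m ≤ n). Then the intersection of the left annihilators ⋂_{i=1}^m ann(v_i) has K-dimension |G| − m·n, where ann(v_i) = {x ∈ K[G] : x·v_i = 0}. -/
/-- Over an algebraically closed field, the action of an algebra on a finite-dimensional simple
module moves linearly independent vectors to arbitrary prescribed vectors. -/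
theorem IsSimpleModule.exists_smul_eq_of_linearIndependent {k A V ι : Type*} [Field k]
    [IsAlgClosed k] [Ring A] [Algebra k A] [AddCommGroup V] [Module k V] [Module A V]
    [IsScalarTower k A V] [IsSimpleModule A V] [FiniteDimensional k V] [Fintype ι]
    {v : ι → V} (hv : LinearIndependent k v) (w : ι → V) :
    ∃ a : A, ∀ i, a • v i = w i := by
  classical
  obtain ⟨g, hg⟩ := LinearMap.exists_extend ((Module.Basis.span hv).constr k w)
  have hgv (i : ι) : g (v i) = w i := by
    have h := congr($hg (Module.Basis.span hv i))
    rwa [Module.Basis.constr_basis, LinearMap.comp_apply, Submodule.subtype_apply,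
      Module.Basis.span_apply] at h
  let f : Module.End (Module.End A V) V :=
    { g with
      map_smul' := fun φ x ↦ by
        obtain ⟨c, rfl⟩ := (IsSimpleModule.algebraMap_end_bijective_of_isAlgClosed k).2 φ
        simp }
  obtain ⟨a, ha⟩ := jacobson_density f (Finset.univ.image v)
  exact ⟨a, fun i ↦ by rw [← ha (v i) (by simp), ← hgv i]; rfl⟩

/-- Let `V` be a simple `K[G]`-module of `K`-dimension `n` and `v 1, …, v m ∈ V` be
`K`-linearly independent. Then `⋂ i, ann(v i)` has `K`-dimension `|G| - m·n`. -/
theorem finrank_iInf_annihilator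
    (K : Type*) [Field K] [IsAlgClosed K] [CharZero K]
    (G : Type*) [Group G] [Fintype G]
    (V : Type*) [AddCommGroup V] [Module K V] [Module (MonoidAlgebra K G) V]
    [IsScalarTower K (MonoidAlgebra K G) V]
    (hV : IsSimpleModule (MonoidAlgebra K G) V)
    (n m : ℕ) (hn : Module.finrank K V = n)
    (v : Fin m → V) (hv : LinearIndependent K v) :
    Module.finrank K
      ↥(⨅ i, LinearMap.ker
          ((LinearMap.toSpanSingleton (MonoidAlgebra K G) V (v i)).restrictScalars K)) =
      Fintype.card G - m * n := by
  let e : MonoidAlgebra K G ≃ₗ[K] (G →₀ K) := MonoidAlgebra.coeffLinearEquiv K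
  have : FiniteDimensional K (MonoidAlgebra K G) := .equiv e.symm
  have : FiniteDimensional K V :=
    Module.Finite.trans (MonoidAlgebra K G) V
  let ev : MonoidAlgebra K G →ₗ[K] (Fin m → V) := LinearMap.pi fun i ↦
    (LinearMap.toSpanSingleton (MonoidAlgebra K G) V (v i)).restrictScalars K
  have hev : LinearMap.range ev = ⊤ := LinearMap.range_eq_top.2 fun w ↦
    (IsSimpleModule.exists_smul_eq_of_linearIndependent hv w).imp fun _ ha ↦ funext ha
  have h := ev.finrank_range_add_finrank_ker
  rw [hev, finrank_top, Module.finrank_pi_fintype, LinearMap.ker_pi, e.finrank_eq,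
    Module.finrank_finsupp_self] at h
  simp only [hn, Finset.sum_const, Finset.card_univ, Fintype.card_fin, smul_eq_mul] at h
  exact Nat.eq_sub_of_add_eq' h
end

section
/- Let V be a simple K[G]-module, let v_1, …, v_n ∈ V, and set a = (v_1, …, v_n) ∈ V^n. Let π_î : V^n → V^{n−1} be the K[G]-linear projection omitting the i-th coordinate. Then v_i lies in the K-linear span of {v_j : j ≠ i} if and only if the restriction of π_î to the cyclic submodule K[G]·a is injective (equivalently, K[G]·a intersects the i-th coordinate copy of V trivially). -/
/-- Over an algebraically closed field, a linear endomorphism of a finite-dimensional simple module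
agrees on any finite set with the action of some element of the algebra. -/
theorem IsSimpleModule.exists_smul_eq_of_isAlgClosed (K : Type*) {A V : Type*} [Field K]
    [IsAlgClosed K] [Ring A] [Algebra K A] [AddCommGroup V] [Module K V] [Module A V]
    [IsScalarTower K A V] [IsSimpleModule A V] [FiniteDimensional K V] (T : V →ₗ[K] V)
    (s : Finset V) : ∃ r : A, ∀ x ∈ s, T x = r • x := by
  let T' : Module.End (Module.End A V) V :=
    { toFun := T
      map_add' := T.map_add
      map_smul' := fun f x => by
        obtain ⟨c, rfl⟩ :=
          (IsSimpleModule.algebraMap_end_bijective_of_isAlgClosed (A := A) (V := V) K).2 f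
        exact T.map_smul c x }
  exact jacobson_density T' s

/-- Let `V` be a simple `K[G]`-module, `v 1, …, v n ∈ V` and `a = (v 1, …, v n) ∈ V^n`.
Then `v i` lies in the `K`-span of the other `v j` iff the projection `π_î : V^n → V^{n-1}`
omitting the `i`-th coordinate is injective on the cyclic submodule `K[G]·a`. -/
theorem mem_span_iff_proj_injOn_cyclic
    (K : Type*) [Field K] [IsAlgClosed K] [CharZero K]
    (G : Type*) [Group G] [Fintype G]
    (V : Type*) [AddCommGroup V] [Module K V] [Module (MonoidAlgebra K G) V]
    [IsScalarTower K (MonoidAlgebra K G) V]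
    (hV : IsSimpleModule (MonoidAlgebra K G) V)
    (n : ℕ) (v : Fin n → V) (i : Fin n) :
    v i ∈ Submodule.span K (v '' {j | j ≠ i}) ↔
      Set.InjOn
        (LinearMap.pi fun j : {j : Fin n // j ≠ i} =>
          (LinearMap.proj (R := MonoidAlgebra K G) (φ := fun _ : Fin n => V) (j : Fin n)))
        (Submodule.span (MonoidAlgebra K G) {v} : Submodule (MonoidAlgebra K G) (Fin n → V)) := by
  have hcomm : SMulCommClass K (MonoidAlgebra K G) V := IsScalarTower.to_smulCommClass
  constructor
  · intro hv x hx y hy hxy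
    obtain ⟨r, rfl⟩ := Submodule.mem_span_singleton.mp hx
    obtain ⟨s, rfl⟩ := Submodule.mem_span_singleton.mp hy
    have hne : ∀ j, j ≠ i → r • v j = s • v j := fun j hj => congrFun hxy ⟨j, hj⟩
    have hle : Submodule.span K (v '' {j | j ≠ i}) ≤
        LinearMap.eqLocus (DistribSMul.toLinearMap K V r) (DistribSMul.toLinearMap K V s) := by
      rw [Submodule.span_le]
      rintro _ ⟨j, hj, rfl⟩
      exact hne j hj
    funext j
    by_cases hj : j = i
    · subst hj
      exact hle hv
    · exact hne j hj
  · intro hinj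
    by_contra hv
    have : Module.Finite K V := Module.Finite.trans (MonoidAlgebra K G) V
    obtain ⟨φ, hφ0, hφ⟩ := Submodule.exists_dual_map_eq_bot_of_notMem hv inferInstance
    classical
    obtain ⟨r, hr⟩ := IsSimpleModule.exists_smul_eq_of_isAlgClosed (A := MonoidAlgebra K G) K
      (φ.smulRight (v i)) (Finset.univ.image v)
    replace hr : ∀ j, φ (v j) • v i = r • v j := fun j =>
      hr (v j) (Finset.mem_image_of_mem v (Finset.mem_univ j))
    have hrv : r • v = 0 := by
      refine hinj (Submodule.smul_mem _ r (Submodule.mem_span_singleton_self v))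
        (Submodule.zero_mem _) (funext fun j => ?_)
      have hj : φ (v j) = 0 := Submodule.map_le_iff_le_comap.mp hφ.le
        (Submodule.subset_span ⟨j, j.2, rfl⟩)
      simpa [hj] using (hr j).symm
    have hi : φ (v i) • v i = 0 := (hr i).trans (congrFun hrv i)
    rcases smul_eq_zero.mp hi with h | h
    · exact hφ0 h
    · exact hφ0 (by rw [h, map_zero])
end

section
/- Let V be a simple K[G]-module, let v_1, …, v_n ∈ V, and set a = (v_1, …, v_n) ∈ V^n. Then for m ≤ n, the cyclic submodule K[G]·a is isomorphic to V^m as a K[G]-module if and only if the K-dimension of the K-linear span of {v_1, …, v_n} equals m. -/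
open Module in
/-- Over an algebraically closed field, a tuple of linearly independent vectors in a
finite-dimensional simple module `V` generates the whole power of `V`. -/
theorem IsSimpleModule.span_singleton_eq_top_of_linearIndependent
    (K : Type*) {A V ι : Type*} [Field K] [IsAlgClosed K] [Ring A] [Algebra K A]
    [AddCommGroup V] [Module K V] [Module A V] [IsScalarTower K A V]
    [IsSimpleModule A V] [FiniteDimensional K V] [Finite ι]
    {w : ι → V} (hw : LinearIndependent K w) :
    Submodule.span A {w} = ⊤ := by
  classical
  have := Fintype.ofFinite ι
  refine Submodule.eq_top_iff'.2 fun x ↦ Submodule.mem_span_singleton.2 ?_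
  obtain ⟨f, hf⟩ := LinearMap.exists_extend ((Basis.span hw).constr K x)
  have hfw (i : ι) : f (w i) = x i := by
    have h := congr($hf (Basis.span hw i))
    rw [Basis.constr_basis, LinearMap.comp_apply, Submodule.subtype_apply, Basis.span_apply] at h
    exact h
  let F : End (End A V) V :=
    { f with
      map_smul' := fun g y ↦ by
        obtain ⟨c, rfl⟩ := (IsSimpleModule.algebraMap_end_bijective_of_isAlgClosed
          (A := A) (V := V) K).2 g
        exact f.map_smul c y }
  obtain ⟨r, hr⟩ := jacobson_density F (Finset.univ.image w)
  exact ⟨r, funext fun i ↦ ((hr (w i) (by simp)).symm.trans (hfw i))⟩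

/-- A scalar annihilates a tuple of vectors iff it annihilates the linear span of the tuple. -/
theorem mem_ker_toSpanSingleton_iff_span_range_le
    (K : Type*) {A V ι : Type*} [CommRing K] [Ring A] [Algebra K A]
    [AddCommGroup V] [Module K V] [Module A V] [IsScalarTower K A V]
    (u : ι → V) (r : A) :
    r ∈ (LinearMap.toSpanSingleton A (ι → V) u).ker ↔
      Submodule.span K (Set.range u) ≤ (Algebra.lsmul K K V r).ker := by
  simp [Submodule.span_le, Set.range_subset_iff, funext_iff]

/-- Two tuples of vectors with the same linear span have the same annihilator. -/
theorem ker_toSpanSingleton_eq_of_span_range_eq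
    (K : Type*) {A V ι κ : Type*} [CommRing K] [Ring A] [Algebra K A]
    [AddCommGroup V] [Module K V] [Module A V] [IsScalarTower K A V]
    {v : ι → V} {w : κ → V}
    (h : Submodule.span K (Set.range v) = Submodule.span K (Set.range w)) :
    (LinearMap.toSpanSingleton A (ι → V) v).ker =
      (LinearMap.toSpanSingleton A (κ → V) w).ker := by
  ext r
  rw [mem_ker_toSpanSingleton_iff_span_range_le K, mem_ker_toSpanSingleton_iff_span_range_le K, h]

open Module in
/-- Over an algebraically closed field, the cyclic submodule generated by a tuple `v` of vectors in
a finite-dimensional simple module `V` is a power of `V`, with exponent the dimension of the linear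
span of `v`. -/
theorem IsSimpleModule.nonempty_span_singleton_equiv_pi
    (K : Type*) {A V ι : Type*} [Field K] [IsAlgClosed K] [Ring A] [Algebra K A]
    [AddCommGroup V] [Module K V] [Module A V] [IsScalarTower K A V]
    [IsSimpleModule A V] [FiniteDimensional K V] (v : ι → V) :
    Nonempty (Submodule.span A {v} ≃ₗ[A]
      (Fin (finrank K (Submodule.span K (Set.range v))) → V)) := by
  let b := finBasis K (Submodule.span K (Set.range v))
  let w : Fin (finrank K (Submodule.span K (Set.range v))) → V := fun i ↦ b i
  have hw : LinearIndependent K w :=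
    b.linearIndependent.map' (Submodule.subtype _) (Submodule.ker_subtype _)
  have hspan : Submodule.span K (Set.range v) = Submodule.span K (Set.range w) := by
    have := congr(Submodule.map (Submodule.subtype _) $(b.span_eq))
    rw [Submodule.map_span, Submodule.map_top, Submodule.range_subtype, ← Set.range_comp] at this
    exact this.symm
  have hsurj : Function.Surjective (LinearMap.toSpanSingleton A _ w) := by
    rw [← LinearMap.range_eq_top, LinearMap.range_toSpanSingleton]
    exact span_singleton_eq_top_of_linearIndependent K hw
  exact ⟨(LinearEquiv.ofEq _ _ (LinearMap.range_toSpanSingleton v).symm).trans <|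
    (LinearMap.quotKerEquivRange _).symm.trans <|
    (Submodule.quotEquivOfEq _ _ (ker_toSpanSingleton_eq_of_span_range_eq K hspan)).trans <|
    LinearMap.quotKerEquivOfSurjective _ hsurj⟩

/-- Let `V` be a simple `K[G]`-module, `v 1, …, v n ∈ V`, `a = (v 1, …, v n) ∈ V^n` and
`m ≤ n`. Then `K[G]·a ≅ V^m` as `K[G]`-modules iff the `K`-span of `{v 1, …, v n}` has
`K`-dimension `m`. -/
theorem cyclic_iso_pow_iff_finrank_span_eq
    (K : Type*) [Field K] [IsAlgClosed K] [CharZero K]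
    (G : Type*) [Group G] [Fintype G]
    (V : Type*) [AddCommGroup V] [Module K V] [Module (MonoidAlgebra K G) V]
    [IsScalarTower K (MonoidAlgebra K G) V]
    (hV : IsSimpleModule (MonoidAlgebra K G) V)
    (n m : ℕ) (hm : m ≤ n) (v : Fin n → V) :
    Nonempty
      ((Submodule.span (MonoidAlgebra K G) {v} : Submodule (MonoidAlgebra K G) (Fin n → V))
        ≃ₗ[MonoidAlgebra K G] (Fin m → V)) ↔
      Module.finrank K (Submodule.span K (Set.range v)) = m := by
  have : FiniteDimensional K V := Module.Finite.trans (MonoidAlgebra K G) V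
  have : Nontrivial V := IsSimpleModule.nontrivial (MonoidAlgebra K G) V
  obtain ⟨e⟩ := IsSimpleModule.nonempty_span_singleton_equiv_pi K (A := MonoidAlgebra K G) v
  constructor
  · rintro ⟨e'⟩
    have h := ((e.symm.trans e').restrictScalars K).finrank_eq
    simpa [Module.finrank_pi_fintype, Module.finrank_pos.ne'] using h
  · rintro rfl
    exact ⟨e⟩
end

section
/- Let {V_1, …, V_n} be a full set of representatives of the isomorphism classes of simple K[G]-modules, with dim_K V_i = n_i. Let M = ⊕_{i=1}^n V_i^{m_i} and let a ∈ M be the element whose component in the j-th copy of V_i is v_j^i ∈ V_i (for 1 ≤ j ≤ m_i). Then K[G]·a = M (equivalently, the glider representation M ⊃ K·a of the length-one filtration K ⊂ K[G] is irreducible) if and only if for every i the vectors v_1^i, …, v_{m_i}^i are K-linearly independent in V_i (in particular m_i ≤ n_i for all i). -/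
/-- A linear map out of a finite double product is the sum of its restrictions to the factors. -/
theorem LinearMap.apply_eq_sum_single_single {R ι : Type*} [Fintype ι] [DecidableEq ι]
    {κ : ι → Type*} [∀ i, Fintype (κ i)] [∀ i, DecidableEq (κ i)] [Semiring R]
    {V : ι → Type*} [∀ i, AddCommMonoid (V i)] [∀ i, Module R (V i)]
    {W : Type*} [AddCommMonoid W] [Module R W]
    (f : (∀ i, κ i → V i) →ₗ[R] W) (x : ∀ i, κ i → V i) :
    f x = ∑ i, ∑ j, f (Pi.single i (Pi.single j (x i j))) := by
  conv_lhs => rw [← Finset.univ_sum_single x, map_sum]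
  refine Finset.sum_congr rfl fun i _ => ?_
  conv_lhs => rw [← Finset.univ_sum_single (x i)]
  exact map_sum (f ∘ₗ LinearMap.single R (fun i => κ i → V i) i)
    (fun j => Pi.single j (x i j)) Finset.univ

/-- If an element of a product of powers of nontrivial modules over a `K`-algebra generates the
product, then its components in each isotypic factor are `K`-linearly independent. -/
theorem linearIndependent_components_of_span_eq_top {K A ι : Type*} [Field K] [Ring A]
    [Algebra K A] {κ : ι → Type*} [∀ i, Fintype (κ i)] {V : ι → Type*}
    [∀ i, AddCommGroup (V i)] [∀ i, Module K (V i)] [∀ i, Module A (V i)]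
    [∀ i, IsScalarTower K A (V i)] [∀ i, Nontrivial (V i)] {v : ∀ i, κ i → V i}
    (h : Submodule.span A {v} = ⊤) (i : ι) : LinearIndependent K (v i) := by
  classical
  rw [Fintype.linearIndependent_iff]
  intro c hc j
  have : SMulCommClass A K (V i) := IsScalarTower.to_smulCommClass'
  let f : (∀ i, κ i → V i) →ₗ[A] V i :=
    ∑ j, c j • (LinearMap.proj (φ := fun _ => V i) j ∘ₗ LinearMap.proj (φ := fun i => κ i → V i) i)
  have hf (x : ∀ i, κ i → V i) : f x = ∑ j, c j • x i j := by simp [f]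
  have hf0 : f = 0 := by
    refine LinearMap.ext_on h ?_
    rintro _ rfl
    simpa [hf] using hc
  obtain ⟨x, hx⟩ := exists_ne (0 : V i)
  have hx0 : f (Pi.single i (Pi.single j x)) = 0 := by simp [hf0]
  rw [hf, Finset.sum_eq_single j (fun k _ hk => by simp [hk]) (by simp)] at hx0
  simpa [hx] using hx0

/-- Over an algebraically closed field `K`, let the `V i` be pairwise non-isomorphic simple modules
over a finite-dimensional `K`-algebra. A linear map from a product of powers of the `V i` to `V i₀`
that kills an element whose components in `V i₀` are linearly independent is zero. -/
theorem LinearMap.eq_zero_of_linearIndependent_components {K A ι : Type*} [Field K]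
    [IsAlgClosed K] [Ring A] [Algebra K A] [FiniteDimensional K A] [Fintype ι] {κ : ι → Type*}
    [∀ i, Fintype (κ i)] {V : ι → Type*} [∀ i, AddCommGroup (V i)] [∀ i, Module K (V i)]
    [∀ i, Module A (V i)] [∀ i, IsScalarTower K A (V i)] [∀ i, IsSimpleModule A (V i)]
    (hV : ∀ i j, i ≠ j → IsEmpty (V i ≃ₗ[A] V j)) {v : ∀ i, κ i → V i} {i₀ : ι}
    (hv : LinearIndependent K (v i₀)) (f : (∀ i, κ i → V i) →ₗ[A] V i₀) (hf : f v = 0) :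
    f = 0 := by
  classical
  have : SMulCommClass A K (V i₀) := IsScalarTower.to_smulCommClass'
  have : FiniteDimensional K (V i₀) := Module.Finite.trans A (V i₀)
  let g (i : ι) (j : κ i) : V i →ₗ[A] V i₀ :=
    f ∘ₗ LinearMap.single A (fun i => κ i → V i) i ∘ₗ LinearMap.single A (fun _ => V i) j
  have hg (i : ι) (hi : i ≠ i₀) (j : κ i) : g i j = 0 :=
    (LinearMap.bijective_or_eq_zero (g i j)).resolve_left fun h =>
      (hV i i₀ hi).elim (LinearEquiv.ofBijective _ h)
  have hc (j : κ i₀) : ∃ c : K, ∀ x, g i₀ j x = c • x := by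
    obtain ⟨c, hc⟩ :=
      (IsSimpleModule.algebraMap_end_bijective_of_isAlgClosed (A := A) (V := V i₀) K).2 (g i₀ j)
    exact ⟨c, fun x => by rw [← hc, Module.algebraMap_end_apply]⟩
  choose c hc using hc
  have hfx (x : ∀ i, κ i → V i) : f x = ∑ j, c j • x i₀ j := by
    rw [f.apply_eq_sum_single_single x, Finset.sum_eq_single i₀ _ (by simp)]
    · exact Finset.sum_congr rfl fun j _ => hc j _
    · exact fun i _ hi => Finset.sum_eq_zero fun j _ => LinearMap.congr_fun (hg i hi j) _
  have hc0 := Fintype.linearIndependent_iff.1 hv c ((hfx v).symm.trans hf)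
  exact LinearMap.ext fun x => by simp [hfx, hc0]

universe u

/-- Let `V 1, …, V n` be a full set of representatives of the isomorphism classes of simple
`K[G]`-modules, with `dim_K (V i) = d i`. For `M = ⊕ i, (V i)^(m i)` and
`a = (v_j^i)_{i,j} ∈ M`, we have `K[G]·a = M` (i.e. the glider `M ⊃ K·a` of the filtration
`K ⊂ K[G]` is irreducible) iff for every `i` the vectors `v_1^i, …, v_{m i}^i` are
`K`-linearly independent in `V i`. -/
theorem span_eq_top_iff_linearIndependent_components
    (K : Type u) [Field K] [IsAlgClosed K] [CharZero K]
    (G : Type u) [Group G] [Fintype G]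
    (n : ℕ) (V : Fin n → Type u)
    [∀ i, AddCommGroup (V i)] [∀ i, Module K (V i)]
    [∀ i, Module (MonoidAlgebra K G) (V i)]
    [∀ i, IsScalarTower K (MonoidAlgebra K G) (V i)]
    (hsimple : ∀ i, IsSimpleModule (MonoidAlgebra K G) (V i))
    (hnoniso : ∀ i j, i ≠ j → IsEmpty ((V i) ≃ₗ[MonoidAlgebra K G] (V j)))
    (hfull : ∀ (W : Type u) [AddCommGroup W] [Module (MonoidAlgebra K G) W],
      IsSimpleModule (MonoidAlgebra K G) W → ∃ i, Nonempty (W ≃ₗ[MonoidAlgebra K G] V i))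
    (d : Fin n → ℕ) (hd : ∀ i, Module.finrank K (V i) = d i)
    (m : Fin n → ℕ) (v : ∀ i, Fin (m i) → V i) :
    Submodule.span (MonoidAlgebra K G)
        {(fun i => v i : ∀ i, Fin (m i) → V i)} = ⊤ ↔
      ∀ i, LinearIndependent K (v i) := by
  refine ⟨fun h i => ?_, fun hv => ?_⟩
  · have (i : Fin n) : Nontrivial (V i) := IsSimpleModule.nontrivial (MonoidAlgebra K G) (V i)
    exact linearIndependent_components_of_span_eq_top h i
  · by_contra hne
    obtain ⟨N, hN, hle⟩ := (eq_top_or_exists_le_coatom _).resolve_left hne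
    have : IsSimpleModule (MonoidAlgebra K G) ((∀ i, Fin (m i) → V i) ⧸ N) :=
      isSimpleModule_iff_isCoatom.2 hN
    obtain ⟨i₀, ⟨e⟩⟩ := hfull _ this
    have hzero := LinearMap.eq_zero_of_linearIndependent_components hnoniso (hv i₀)
      (e.toLinearMap ∘ₗ N.mkQ) (by simpa using hle)
    refine hN.1 (eq_top_iff.2 fun x _ => ?_)
    simpa using LinearMap.congr_fun hzero x
end

section
/- Let p be a prime, G a finite p-group, and N a normal subgroup of G of index p. Let V and W be irreducible K-linear representations of G which lie over the same irreducible representation U of N, i.e., U is isomorphic to a subrepresentation of both the restriction of V to N and the restriction of W to N. Then dim_K V = dim_K W. -/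
open MonoidAlgebra

/-- A subgroup containing a subgroup `N` of prime index is either `N` or the whole group. -/
lemma Subgroup.eq_or_eq_top_of_index_prime {G : Type*} [Group G] {N H : Subgroup G}
    (hN : N.index.Prime) (h : N ≤ H) : H = N ∨ H = ⊤ := by
  rcases (Nat.dvd_prime hN).mp ⟨_, ((mul_comm _ _).trans (relIndex_mul_index h)).symm⟩ with h1 | h1
  · exact .inr (index_eq_one.mp h1)
  · refine .inl (le_antisymm (relIndex_eq_one.mp ?_) h)
    have := relIndex_mul_index h
    rw [h1] at this
    exact Nat.eq_of_mul_eq_mul_right hN.pos (this.trans (one_mul _).symm)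

noncomputable section

namespace MonoidAlgebra

section Action

variable {K G V : Type*} [Field K] [Group G] [AddCommGroup V] [Module (MonoidAlgebra K G) V]

lemma of_smul_of_smul (a b : G) (v : V) : of K G a • of K G b • v = of K G (a * b) • v := by
  rw [← mul_smul, ← map_mul]

lemma of_one_smul (v : V) : of K G 1 • v = v := by
  rw [map_one, one_smul]

variable [Module K V] [IsScalarTower K (MonoidAlgebra K G) V]

/-- The action of a group element on a module over the group algebra, as a linear equivalence. -/
def ofSMulEquiv (g : G) : V ≃ₗ[K] V :=
  .ofLinearMap (Algebra.lsmul K K V (of K G g)) (Algebra.lsmul K K V (of K G g⁻¹))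
    (LinearMap.ext fun v => (of_smul_of_smul _ _ v).trans (by simp [-of_apply]))
    (LinearMap.ext fun v => (of_smul_of_smul _ _ v).trans (by simp [-of_apply]))

lemma ofSMulEquiv_apply (g : G) (v : V) : ofSMulEquiv (K := K) g v = of K G g • v := rfl

lemma eq_top_of_forall_of_smul_mem [IsSimpleModule (MonoidAlgebra K G) V]
    (T : Submodule K V) {v : V} (hv : v ≠ 0) (h : ∀ g : G, of K G g • v ∈ T) : T = ⊤ := by
  refine eq_top_iff.mpr fun w _ => ?_
  obtain ⟨r, rfl⟩ := IsSimpleModule.toSpanSingleton_surjective (MonoidAlgebra K G) hv w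
  rw [LinearMap.toSpanSingleton_apply]
  clear * - h
  induction r using MonoidAlgebra.induction_on with
  | of g => exact h g
  | add x y hx hy => rw [add_smul]; exact T.add_mem hx hy
  | smul c x hx => rw [smul_assoc]; exact T.smul_mem c hx

end Action

section Normal

variable {K G : Type*} [Field K] [Group G] {N : Subgroup G} [N.Normal]
  {U : Type*} [AddCommGroup U] [Module K U] [Module (MonoidAlgebra K N) U]

variable (K N U) in
/-- The stabilizer in `G` of the isomorphism class of a representation `U` of a normal
subgroup `N`. -/
def inertiaSubgroup : Subgroup G where
  carrier := {g | ∃ φ : U ≃ₗ[K] U, ∀ (n : N) (u : U),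
    φ (of K N n • u) = of K N (MulAut.conjNormal g n) • φ u}
  one_mem' := ⟨.refl K U, fun n u => by simp⟩
  mul_mem' := by
    rintro a b ⟨φ, hφ⟩ ⟨ψ, hψ⟩
    exact ⟨ψ.trans φ, fun n u => by simp only [LinearEquiv.trans_apply, hψ, hφ, map_mul,
      MulAut.mul_apply]⟩
  inv_mem' := by
    rintro a ⟨φ, hφ⟩
    refine ⟨φ.symm, fun n u => φ.injective ?_⟩
    rw [hφ, φ.apply_symm_apply, φ.apply_symm_apply, map_inv, MulAut.apply_inv_self]

variable [IsScalarTower K (MonoidAlgebra K N) U]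

lemma le_inertiaSubgroup : N ≤ inertiaSubgroup K N U := fun g hg => by
  refine ⟨ofSMulEquiv (⟨g, hg⟩ : N), fun n u => ?_⟩
  rw [ofSMulEquiv_apply, ofSMulEquiv_apply, of_smul_of_smul, of_smul_of_smul]
  congr 2
  ext
  simp

variable {V : Type*} [AddCommGroup V] [Module K V] [Module (MonoidAlgebra K N) V]
  [IsScalarTower K (MonoidAlgebra K N) V]

/-- A `K`-linear map that intertwines the actions of `N` up to conjugation by `g` is semilinear
over the group algebra. -/
def conjSemilinear (g : G) (l : U →ₗ[K] V)
    (hl : ∀ (n : N) (u : U), l (of K N n • u) = of K N (MulAut.conjNormal g n) • l u) :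
    U →ₛₗ[(mapDomainRingEquiv K (MulAut.conjNormal g : N ≃* N) :
      MonoidAlgebra K N →+* MonoidAlgebra K N)] V where
  toFun := l
  map_add' := l.map_add
  map_smul' r u := by
    induction r using MonoidAlgebra.induction_on with
    | of n => simpa using hl n u
    | add x y hx hy => rw [add_smul, map_add, hx, hy, map_add, add_smul]
    | smul c x hx =>
      rw [smul_assoc, map_smul, hx, ← smul_assoc]
      congr 1
      exact (map_smul (domCongr K K (MulAut.conjNormal g : N ≃* N)) c x).symm

variable [Module (MonoidAlgebra K G) V] [IsScalarTower K (MonoidAlgebra K G) V]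

/-- The translate by `g` of an `N`-equivariant map into a representation of `G`. -/
def translate (hres : ∀ (n : N) (v : V), of K N n • v = of K G (n : G) • v)
    (f : U →ₗ[MonoidAlgebra K N] V) (g : G) :
    U →ₛₗ[(mapDomainRingEquiv K (MulAut.conjNormal g : N ≃* N) :
      MonoidAlgebra K N →+* MonoidAlgebra K N)] V :=
  conjSemilinear g ((ofSMulEquiv g).toLinearMap ∘ₗ f.restrictScalars K) fun n u => by
    simp only [LinearMap.comp_apply, LinearMap.coe_restrictScalars, LinearEquiv.coe_coe,
      ofSMulEquiv_apply, map_smul, hres, of_smul_of_smul, MulAut.conjNormal_apply,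
      inv_mul_cancel_right]

lemma translate_apply (hres : ∀ (n : N) (v : V), of K N n • v = of K G (n : G) • v)
    (f : U →ₗ[MonoidAlgebra K N] V) (g : G) (u : U) :
    translate hres f g u = of K G g • f u := rfl

lemma translate_injective (hres : ∀ (n : N) (v : V), of K N n • v = of K G (n : G) • v)
    {f : U →ₗ[MonoidAlgebra K N] V} (hf : Function.Injective f) (g : G) :
    Function.Injective (translate hres f g) :=
  (ofSMulEquiv (K := K) g).injective.comp hf

/-- An embedded `N`-representation is linearly equivalent to each of its translates. -/
def translateEquiv (hres : ∀ (n : N) (v : V), of K N n • v = of K G (n : G) • v)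
    {f : U →ₗ[MonoidAlgebra K N] V} (hf : Function.Injective f) (g : G) :
    U ≃ₗ[K] LinearMap.range (translate hres f g) :=
  .ofBijective (σ₁₂ := RingHom.id K)
    { toFun := (translate hres f g).rangeRestrict
      map_add' := map_add _
      map_smul' := fun c u => Subtype.ext <| map_smul
        ((ofSMulEquiv g).toLinearMap ∘ₗ f.restrictScalars K) c u }
    ⟨fun _ _ h => translate_injective hres hf g (congrArg Subtype.val h),
      (translate hres f g).surjective_rangeRestrict⟩

lemma translateEquiv_of_smul (hres : ∀ (n : N) (v : V), of K N n • v = of K G (n : G) • v)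
    {f : U →ₗ[MonoidAlgebra K N] V} (hf : Function.Injective f) (g : G) (n : N) (u : U) :
    translateEquiv hres hf g (of K N n • u) =
      of K N (MulAut.conjNormal g n) • translateEquiv hres hf g u := by
  refine Subtype.ext ?_
  change of K G g • f (of K N n • u) = of K N _ • of K G g • f u
  simp only [map_smul, hres, of_smul_of_smul, MulAut.conjNormal_apply, inv_mul_cancel_right]

/-- If two translates of an embedded `N`-representation are isomorphic, they are translates by
elements in the same coset of the inertia subgroup. -/
lemma inv_mul_mem_inertiaSubgroup
    (hres : ∀ (n : N) (v : V), of K N n • v = of K G (n : G) • v)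
    {f : U →ₗ[MonoidAlgebra K N] V} (hf : Function.Injective f) {a b : G}
    (e : LinearMap.range (translate hres f a) ≃ₗ[MonoidAlgebra K N]
      LinearMap.range (translate hres f b)) :
    b⁻¹ * a ∈ inertiaSubgroup K N U := by
  refine ⟨(translateEquiv hres hf a).trans
    ((e.restrictScalars K).trans (translateEquiv hres hf b).symm),
    fun n u => (translateEquiv hres hf b).injective ?_⟩
  rw [translateEquiv_of_smul]
  simp only [LinearEquiv.trans_apply, LinearEquiv.apply_symm_apply, translateEquiv_of_smul,
    LinearEquiv.restrictScalars_apply, map_smul, map_mul, map_inv, MulAut.mul_apply,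
    MulAut.apply_inv_self]

/-- If `U` is not stable under conjugation by `G`, every irreducible representation of `G`
over `U` is a direct sum of the translates of `U`. -/
theorem finrank_eq_of_inertiaSubgroup_eq [N.FiniteIndex]
    [IsSimpleModule (MonoidAlgebra K G) V] [IsSimpleModule (MonoidAlgebra K N) U]
    [FiniteDimensional K U]
    (hres : ∀ (n : N) (v : V), of K N n • v = of K G (n : G) • v)
    {f : U →ₗ[MonoidAlgebra K N] V} (hf : Function.Injective f)
    (hI : inertiaSubgroup K N U = N) :
    Module.finrank K V = N.index * Module.finrank K U := by
  classical
  have := Fintype.ofFinite (G ⧸ N)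
  let X (q : G ⧸ N) : Submodule (MonoidAlgebra K N) V := LinearMap.range (translate hres f q.out)
  have hX (q : G ⧸ N) : IsSimpleModule (MonoidAlgebra K N) (X q) :=
    ((translate hres f q.out).rangeRestrict.isSimpleModule_iff_of_bijective
      ⟨fun x y h => translate_injective hres hf _ (congrArg Subtype.val h),
        (translate hres f q.out).surjective_rangeRestrict⟩).mp inferInstance
  have hmem (q : G ⧸ N) : isotypicComponent (MonoidAlgebra K N) V (X q) ∈
      isotypicComponents (MonoidAlgebra K N) V := ⟨X q, hX q, rfl⟩
  have hinj : Function.Injective fun q : G ⧸ N =>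
      (⟨_, hmem q⟩ : isotypicComponents (MonoidAlgebra K N) V) := fun a b hab => by
    have hle : X a ≤ isotypicComponent (MonoidAlgebra K N) V (X b) :=
      (X a).le_isotypicComponent.trans (congrArg Subtype.val hab).le
    have hb : IsIsotypicOfType (MonoidAlgebra K N)
        (isotypicComponent (MonoidAlgebra K N) V (X b)) (X b) :=
      .isotypicComponent (MonoidAlgebra K N) V (X b)
    let i := Submodule.submoduleOfEquivOfLe hle
    have : IsSimpleModule (MonoidAlgebra K N)
        ((X a).submoduleOf (isotypicComponent (MonoidAlgebra K N) V (X b))) := .congr i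
    obtain ⟨e⟩ := hb ((X a).submoduleOf _)
    rw [← a.out_eq', ← b.out_eq', eq_comm, QuotientGroup.eq]
    exact hI.le (inv_mul_mem_inertiaSubgroup hres hf (i.symm.trans e))
  have hind : iSupIndep X :=
    (((sSupIndep_iff _).mp (sSupIndep_isotypicComponents (MonoidAlgebra K N) V)).comp hinj).mono
      fun q => (X q).le_isotypicComponent
  have htop : ⨆ q, X q = ⊤ := by
    obtain ⟨u, hu⟩ := @exists_ne U (IsSimpleModule.nontrivial (MonoidAlgebra K N) U) 0
    rw [← Submodule.restrictScalars_eq_top_iff K]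
    refine eq_top_of_forall_of_smul_mem (G := G) _ ((map_ne_zero_iff f hf).mpr hu) fun g => ?_
    obtain ⟨n, hn⟩ := QuotientGroup.mk_out_eq_mul N g
    refine Submodule.mem_iSup_of_mem (g : G ⧸ N) ⟨of K N n⁻¹ • u, ?_⟩
    rw [translate_apply, map_smul, hres, of_smul_of_smul, hn]
    simp
  have hint := DirectSum.isInternal_submodule_of_iSupIndep_of_iSup_eq_top hind htop
  have (q : G ⧸ N) : FiniteDimensional K (X q) :=
    .of_surjective _ (translateEquiv hres hf q.out).surjective
  rw [← ((LinearEquiv.ofBijective (DirectSum.coeLinearMap X) hint).restrictScalars K).finrank_eq,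
    Module.finrank_directSum,
    Finset.sum_congr rfl fun q _ => (translateEquiv hres hf q.out).finrank_eq.symm,
    Finset.sum_const, Finset.card_univ, smul_eq_mul, Subgroup.index, Nat.card_eq_fintype_card]

/-- If `U` is stable under conjugation by `G` and `G ⧸ N` has prime order, every irreducible
representation of `G` over `U` restricts to `U`. -/
theorem finrank_eq_of_inertiaSubgroup_eq_top [IsAlgClosed K]
    [IsSimpleModule (MonoidAlgebra K G) V] [IsSimpleModule (MonoidAlgebra K N) U]
    [FiniteDimensional K U] [FiniteDimensional K V]
    (hN : N.index.Prime)
    (hres : ∀ (n : N) (v : V), of K N n • v = of K G (n : G) • v)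
    {f : U →ₗ[MonoidAlgebra K N] V} (hf : Function.Injective f)
    (hI : inertiaSubgroup K N U = ⊤) :
    Module.finrank K V = Module.finrank K U := by
  obtain ⟨u₀, hu₀⟩ := @exists_ne U (IsSimpleModule.nontrivial (MonoidAlgebra K N) U) 0
  obtain ⟨g, hg⟩ : ∃ g, g ∉ N := by
    by_contra! h
    exact hN.one_lt.ne' (Subgroup.index_eq_one.mpr ((Subgroup.eq_top_iff' N).mpr h))
  obtain ⟨φ, hφ⟩ : g ∈ inertiaSubgroup K N U := hI ▸ Subgroup.mem_top g
  have hφ' (n : N) (u : U) :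
      φ.symm (of K N n • u) = of K N (MulAut.conjNormal g⁻¹ n) • φ.symm u := by
    rw [φ.symm_apply_eq, hφ, φ.apply_symm_apply, map_inv, MulAut.apply_inv_self]
  -- Conjugating `N`-equivariant maps `U → V` by the action of `g` has an eigenvector.
  let T : Module.End K (U →ₗ[MonoidAlgebra K N] V) :=
    { toFun := fun h => equivariantOfLinearOfComm
        ((ofSMulEquiv g).toLinearMap ∘ₗ h.restrictScalars K ∘ₗ φ.symm.toLinearMap) fun n u => by
          change of K G g • h (φ.symm (of K N n • u)) = of K N n • of K G g • h (φ.symm u)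
          rw [hφ', map_smul, hres, hres, of_smul_of_smul, of_smul_of_smul]
          congr 2
          simp [mul_assoc]
      map_add' := fun h₁ h₂ => LinearMap.ext fun u => smul_add _ _ _
      map_smul' := fun c h => LinearMap.ext fun u =>
        smul_comm (of K G g) c (h (φ.symm u)) }
  have hT (h : U →ₗ[MonoidAlgebra K N] V) (u : U) : T h u = of K G g • h (φ.symm u) := rfl
  have : FiniteDimensional K (U →ₗ[MonoidAlgebra K N] V) :=
    .of_injective (LinearMap.restrictScalarsₗ K (MonoidAlgebra K N) U V K)
      (LinearMap.restrictScalars_injective _)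
  have : Nontrivial (U →ₗ[MonoidAlgebra K N] V) :=
    ⟨f, 0, fun h => (map_ne_zero_iff f hf).mpr hu₀ (by rw [h, LinearMap.zero_apply])⟩
  obtain ⟨c, hc⟩ := Module.End.exists_eigenvalue T
  obtain ⟨h, hh⟩ := hc.exists_hasEigenvector
  have hinj : Function.Injective h := h.injective_or_eq_zero.resolve_right hh.2
  have hgh (u : U) : of K G g • h u = h (c • φ u) := by
    have := hT h (φ u)
    rw [hh.apply_eq_smul, φ.symm_apply_apply] at this
    rw [LinearMap.map_smul_of_tower, ← this, LinearMap.smul_apply]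
  have hc0 : c ≠ 0 := by
    rintro rfl
    refine (map_ne_zero_iff h hinj).mpr hu₀ ((ofSMulEquiv (K := K) g).injective ?_)
    rw [ofSMulEquiv_apply, hgh, zero_smul, map_zero, map_zero]
  let S : Subgroup G :=
    { carrier := {a | ∃ ψ : U ≃ₗ[K] U, ∀ u, of K G a • h u = h (ψ u)}
      one_mem' := ⟨.refl K U, fun u => of_one_smul (h u)⟩
      mul_mem' := by
        rintro a b ⟨φ, hφ⟩ ⟨ψ, hψ⟩
        exact ⟨ψ.trans φ, fun u => by rw [← of_smul_of_smul, hψ, hφ, LinearEquiv.trans_apply]⟩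
      inv_mem' := by
        rintro a ⟨φ, hφ⟩
        refine ⟨φ.symm, fun u => (ofSMulEquiv (K := K) a).injective ?_⟩
        rw [ofSMulEquiv_apply, ofSMulEquiv_apply, of_smul_of_smul, hφ, φ.apply_symm_apply,
          mul_inv_cancel, of_one_smul] }
  have hNS : N ≤ S := fun n hn => ⟨ofSMulEquiv (⟨n, hn⟩ : N), fun u => by
    rw [ofSMulEquiv_apply, map_smul, hres]⟩
  have hgS : g ∈ S := ⟨φ.trans (.smulOfNeZero K U c hc0), hgh⟩
  have hS : S = ⊤ :=
    (Subgroup.eq_or_eq_top_of_index_prime hN hNS).resolve_left fun h => hg (h ▸ hgS)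
  have hrange : LinearMap.range (h.restrictScalars K) = ⊤ :=
    eq_top_of_forall_of_smul_mem (G := G) _ ((map_ne_zero_iff h hinj).mpr hu₀) fun a => by
      obtain ⟨ψ, hψ⟩ : a ∈ S := hS ▸ Subgroup.mem_top a
      exact ⟨ψ u₀, (hψ u₀).symm⟩
  exact (LinearEquiv.ofBijective (h.restrictScalars K)
    ⟨hinj, LinearMap.range_eq_top.mp hrange⟩).finrank_eq.symm

end Normal

end MonoidAlgebra

end

open Classical in
/-- The dimension of an irreducible representation of `G` over an irreducible representation `U`
of a normal subgroup `N` of prime index is determined by `U`. -/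
theorem finrank_eq_ite_of_lie_over {K G : Type*} [Field K] [IsAlgClosed K] [Group G] [Finite G]
    {N : Subgroup G} [N.Normal] (hN : N.index.Prime)
    {V : Type*} [AddCommGroup V] [Module K V] [Module (MonoidAlgebra K G) V]
    [IsScalarTower K (MonoidAlgebra K G) V] [IsSimpleModule (MonoidAlgebra K G) V]
    {U : Type*} [AddCommGroup U] [Module K U] [Module (MonoidAlgebra K N) U]
    [IsScalarTower K (MonoidAlgebra K N) U] [IsSimpleModule (MonoidAlgebra K N) U]
    (f : U →ₗ[K] V) (hf : Function.Injective f)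
    (hfN : ∀ (g : N) (u : U), f (of K N g • u) = of K G (g : G) • f u) :
    Module.finrank K V = if inertiaSubgroup K N U = ⊤ then Module.finrank K U
      else N.index * Module.finrank K U := by
  let : Module (MonoidAlgebra K N) V := Module.compHom V (mapDomainRingHom K N.subtype)
  have hsmul (r : MonoidAlgebra K N) (v : V) : r • v = mapDomainRingHom K N.subtype r • v := rfl
  have hres (n : N) (v : V) : of K N n • v = of K G (n : G) • v := by
    rw [hsmul]
    simp
  have : IsScalarTower K (MonoidAlgebra K N) V := ⟨fun c r v => by
    rw [hsmul, hsmul, ← smul_assoc]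
    congr 1
    exact map_smul (mapDomainAlgHom K K N.subtype) c r⟩
  have : FiniteDimensional K U := Module.Finite.trans (MonoidAlgebra K N) U
  have : FiniteDimensional K V := Module.Finite.trans (MonoidAlgebra K G) V
  let F : U →ₗ[MonoidAlgebra K N] V := equivariantOfLinearOfComm f fun n u =>
    (hfN n u).trans (hres n (f u)).symm
  have hF : Function.Injective F := hf
  split_ifs with h
  · exact finrank_eq_of_inertiaSubgroup_eq_top hN hres hF h
  · exact finrank_eq_of_inertiaSubgroup_eq hres hF
      ((Subgroup.eq_or_eq_top_of_index_prime hN le_inertiaSubgroup).resolve_right h)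

/-- Let `G` be a finite `p`-group and `N ⊴ G` of index `p`. If the irreducible
`K[G]`-modules `V` and `W` lie over the same irreducible `K[N]`-module `U` (i.e. `U` embeds
`N`-equivariantly in both restrictions `V|_N` and `W|_N`), then `dim_K V = dim_K W`. -/
theorem finrank_eq_of_lie_over_same_simple_pGroup
    (K : Type*) [Field K] [IsAlgClosed K] [CharZero K]
    (p : ℕ) (hp : p.Prime)
    (G : Type*) [Group G] [Fintype G] (hG : IsPGroup p G)
    (N : Subgroup G) [N.Normal] (hidx : N.index = p)
    (V : Type*) [AddCommGroup V] [Module K V] [Module (MonoidAlgebra K G) V]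
    [IsScalarTower K (MonoidAlgebra K G) V]
    (W : Type*) [AddCommGroup W] [Module K W] [Module (MonoidAlgebra K G) W]
    [IsScalarTower K (MonoidAlgebra K G) W]
    (hV : IsSimpleModule (MonoidAlgebra K G) V)
    (hW : IsSimpleModule (MonoidAlgebra K G) W)
    (U : Type*) [AddCommGroup U] [Module K U] [Module (MonoidAlgebra K ↥N) U]
    [IsScalarTower K (MonoidAlgebra K ↥N) U]
    (hU : IsSimpleModule (MonoidAlgebra K ↥N) U)
    (hUV : ∃ f : U →ₗ[K] V, Function.Injective f ∧
      ∀ (g : ↥N) (u : U),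
        f ((MonoidAlgebra.of K ↥N g) • u) = (MonoidAlgebra.of K G (g : G)) • f u)
    (hUW : ∃ f : U →ₗ[K] W, Function.Injective f ∧
      ∀ (g : ↥N) (u : U),
        f ((MonoidAlgebra.of K ↥N g) • u) = (MonoidAlgebra.of K G (g : G)) • f u) :
    Module.finrank K V = Module.finrank K W := by
  obtain ⟨f, hf, hfN⟩ := hUV
  obtain ⟨f', hf', hfN'⟩ := hUW
  have hN : N.index.Prime := hidx ▸ hp
  rw [finrank_eq_ite_of_lie_over hN f hf hfN, finrank_eq_ite_of_lie_over hN f' hf' hfN']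
end

section
/- Let G be a finite group and H ≤ Z(G) a subgroup of the center of G. Let M be a K[G]-module and S a simple K[H]-submodule of M (viewing M as a K[H]-module by restriction). Then every simple K[H]-submodule of K[G]·S is isomorphic to S; in other words, K[G]·S is S-isotypic as a K[H]-module. -/
/-- The restriction of scalars making any `K[G]`-module a `K[H]`-module for `H ≤ G`. -/
noncomputable instance subgroupRestrictModule
    (K : Type*) [Field K] (G : Type*) [Group G] (H : Subgroup G)
    (M : Type*) [AddCommGroup M] [Module (MonoidAlgebra K G) M] :
    Module (MonoidAlgebra K ↥H) M :=
  Module.compHom M (MonoidAlgebra.mapDomainRingHom K H.subtype)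

/-- Elements of `K[H]` with `H` central in `G` commute with every element of `K[G]`. -/
theorem mapDomainRingHom_subtype_commute {K G : Type*} [Field K] [Group G] {H : Subgroup G}
    (hH : H ≤ Subgroup.center G) (r : MonoidAlgebra K ↥H) (a : MonoidAlgebra K G) :
    Commute (MonoidAlgebra.mapDomainRingHom K H.subtype r) a := by
  induction r using MonoidAlgebra.induction_linear with
  | zero => simp
  | add r r' hr hr' => simpa only [map_add] using hr.add_left hr'
  | single h k =>
    induction a using MonoidAlgebra.induction_linear with
    | zero => simp
    | add a b ha hb => exact ha.add_right hb
    | single g l =>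
      simp [Commute, SemiconjBy, MonoidAlgebra.single_mul_single, mul_comm k l,
        Subgroup.mem_center_iff.mp (hH h.2) g]

/-- Two simple modules are isomorphic once a nonzero element of the second is annihilated by
everything that annihilates some nonzero element of the first. -/
theorem nonempty_linearEquiv_of_smul_eq_zero_imp {R S T : Type*} [Ring R]
    [AddCommGroup S] [Module R S] [AddCommGroup T] [Module R T]
    [IsSimpleModule R S] [IsSimpleModule R T] {s : S} {t : T} (hs : s ≠ 0) (ht : t ≠ 0)
    (h : ∀ r : R, r • s = 0 → r • t = 0) : Nonempty (T ≃ₗ[R] S) := by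
  have hmax := IsSimpleModule.ker_toSpanSingleton_isMaximal R hs
  have heq := hmax.eq_of_le (IsSimpleModule.ker_toSpanSingleton_isMaximal R ht).ne_top
    fun r hr ↦ by simpa using h r (by simpa using hr)
  exact ⟨(LinearMap.quotKerEquivOfSurjective _
      (IsSimpleModule.toSpanSingleton_surjective R ht)).symm ≪≫ₗ
    Submodule.quotEquivOfEq _ _ heq.symm ≪≫ₗ
    LinearMap.quotKerEquivOfSurjective _ (IsSimpleModule.toSpanSingleton_surjective R hs)⟩

/-- Let `H ≤ Z(G)`, `M` a `K[G]`-module and `S` a simple `K[H]`-submodule of `M`. Then every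
simple `K[H]`-submodule `T` of `K[G]·S` is isomorphic to `S`; i.e. `K[G]·S` is `S`-isotypic
as a `K[H]`-module. -/
theorem isotypic_of_central_subgroup
    (K : Type*) [Field K] [IsAlgClosed K] [CharZero K]
    (G : Type*) [Group G] [Fintype G]
    (H : Subgroup G) (hH : H ≤ Subgroup.center G)
    (M : Type*) [AddCommGroup M] [Module K M] [Module (MonoidAlgebra K G) M]
    [IsScalarTower K (MonoidAlgebra K G) M]
    (S : Submodule (MonoidAlgebra K ↥H) M)
    (hS : IsSimpleModule (MonoidAlgebra K ↥H) ↥S)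
    (T : Submodule (MonoidAlgebra K ↥H) M)
    (hT : IsSimpleModule (MonoidAlgebra K ↥H) ↥T)
    (hTsub : (T : Set M) ⊆
      ((Submodule.span (MonoidAlgebra K G) (S : Set M) :
        Submodule (MonoidAlgebra K G) M) : Set M)) :
    Nonempty (↥T ≃ₗ[MonoidAlgebra K ↥H] ↥S) := by
  have := IsSimpleModule.nontrivial (MonoidAlgebra K ↥H) S
  obtain ⟨s, hs⟩ := exists_ne (0 : S)
  have := IsSimpleModule.nontrivial (MonoidAlgebra K ↥H) T
  obtain ⟨t, ht⟩ := exists_ne (0 : T)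
  refine nonempty_linearEquiv_of_smul_eq_zero_imp hs ht fun r hr ↦ Subtype.ext ?_
  set f := MonoidAlgebra.mapDomainRingHom K H.subtype
  have hrs : f r • (s : M) = 0 := congrArg Subtype.val hr
  have comm (a : MonoidAlgebra K G) (x : M) : f r • a • x = a • f r • x := by
    rw [smul_smul, (mapDomainRingHom_subtype_commute hH r a).eq, mul_smul]
  change f r • (t : M) = 0
  refine Submodule.span_induction (p := fun x _ ↦ f r • x = 0) ?_ (smul_zero _)
    (fun x y _ _ hx hy ↦ by rw [smul_add, hx, hy, add_zero])
    (fun a x _ hx ↦ by rw [comm, hx, smul_zero]) (hTsub t.2)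
  intro x hx
  obtain ⟨r', hr'⟩ := IsSimpleModule.toSpanSingleton_surjective (MonoidAlgebra K ↥H) hs ⟨x, hx⟩
  have hx' : f r' • (s : M) = x := congrArg Subtype.val hr'
  rw [← hx', comm, hrs, smul_zero]
end

section
/- Let p and q be distinct primes, G a finite p-group, H a finite q-group, and let P be an irreducible K-linear representation of the direct product G × H whose K-dimension is a power of p. Then the restriction of P to the subgroup {e} × H ≅ H is isotypic with one-dimensional isotype: there is a one-dimensional representation U' of H such that P restricted to H is isomorphic to the direct sum of dim_K(P) copies of U'. -/
/-- Schur's lemma: a linear endomorphism of a simple finite-dimensional module over a group algebra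
which commutes with the group is a scalar. -/
theorem MonoidAlgebra.exists_eq_smul_of_isSimpleModule
    {K Γ P : Type*} [Field K] [IsAlgClosed K] [Group Γ] [AddCommGroup P] [Module K P]
    [Module (MonoidAlgebra K Γ) P] [IsScalarTower K (MonoidAlgebra K Γ) P]
    [IsSimpleModule (MonoidAlgebra K Γ) P] [FiniteDimensional K P] (f : P →ₗ[K] P)
    (hf : ∀ (g : Γ) (x : P), f (MonoidAlgebra.of K Γ g • x) = MonoidAlgebra.of K Γ g • f x) :
    ∃ c : K, ∀ x, f x = c • x := by
  let F : P →ₗ[MonoidAlgebra K Γ] P :=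
    { toFun := f
      map_add' := f.map_add
      map_smul' := fun a x => by
        induction a using MonoidAlgebra.induction_on with
        | of g => exact hf g x
        | add a b ha hb => simp_all [add_smul]
        | smul r a ha => simp_all [smul_assoc] }
  obtain ⟨c, hc⟩ := (IsSimpleModule.algebraMap_end_bijective_of_isAlgClosed
    (A := MonoidAlgebra K Γ) (V := P) K).2 F
  exact ⟨c, fun x => (LinearMap.congr_fun hc x).symm⟩

/-- If `S * T` and `c • (T * S)` agree for invertible endomorphisms `S`, `T`, then `c` is a root of
unity of order dividing the dimension. -/
theorem LinearMap.pow_finrank_eq_one_of_mul_eq_smul_mul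
    {K P : Type*} [Field K] [AddCommGroup P] [Module K P]
    {S T : Module.End K P} (hS : IsUnit S) (hT : IsUnit T) {c : K} (h : S * T = c • (T * S)) :
    c ^ Module.finrank K P = 1 := by
  have hd := congrArg LinearMap.det h
  rw [LinearMap.det_smul, map_mul, map_mul, mul_comm (LinearMap.det T)] at hd
  exact mul_right_cancel₀ ((hS.map LinearMap.det).mul (hT.map LinearMap.det)).ne_zero
    (by rw [← hd, one_mul])

/-- Let `p ≠ q` be primes, `G` a finite `p`-group, `H` a finite `q`-group, and `P` an
irreducible `K[G × H]`-module whose `K`-dimension is a power of `p`. Then the restriction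
of `P` to `{e} × H ≅ H` is isotypic with one-dimensional isotype: there is a character
`χ : H →* Kˣ` such that every `h ∈ H` acts on `P` as the scalar `χ h`; equivalently,
`P|_H` is the direct sum of `dim_K P` copies of the one-dimensional representation `χ`. -/
theorem restriction_isotypic_of_p_power_dim
    (K : Type*) [Field K] [IsAlgClosed K] [CharZero K]
    (p q : ℕ) (hp : p.Prime) (hq : q.Prime) (hpq : p ≠ q)
    (G : Type*) [Group G] [Fintype G] (hG : IsPGroup p G)
    (H : Type*) [Group H] [Fintype H] (hH : IsPGroup q H)
    (P : Type*) [AddCommGroup P] [Module K P] [Module (MonoidAlgebra K (G × H)) P]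
    [IsScalarTower K (MonoidAlgebra K (G × H)) P]
    (hP : IsSimpleModule (MonoidAlgebra K (G × H)) P)
    (hdim : ∃ α : ℕ, Module.finrank K P = p ^ α) :
    ∃ χ : H →* Kˣ, ∀ (h : H) (x : P),
      (MonoidAlgebra.of K (G × H) ((1 : G), h)) • x = (χ h : K) • x := by
  obtain ⟨α, hα⟩ := hdim
  have := Fact.mk hq
  have : FiniteDimensional K P :=
    Module.finite_of_finrank_pos (hα ▸ pow_pos hp.pos α)
  have : Nontrivial P := IsSimpleModule.nontrivial (MonoidAlgebra K (G × H)) P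
  have : Group.IsNilpotent H := hH.isNilpotent
  let ρ : G × H →* Module.End K P :=
    (Algebra.lsmul K K P : MonoidAlgebra K (G × H) →ₐ[K] Module.End K P).toMonoidHom.comp
      (MonoidAlgebra.of K (G × H))
  have hunit (g : G × H) : IsUnit (ρ g) := (Group.isUnit g).map ρ
  have key (n : ℕ) : ∀ h ∈ Subgroup.upperCentralSeries H n, ∃ c : K, ρ (1, h) = c • 1 := by
    induction n with
    | zero =>
      intro h hh
      rw [Subgroup.upperCentralSeries_zero, Subgroup.mem_bot] at hh
      exact ⟨1, by rw [hh, one_smul]; exact map_one ρ⟩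
    | succ n ih =>
      intro h hh
      have hcomm (y : H) : ρ (1, h) * ρ (1, y) = ρ (1, y) * ρ (1, h) := by
        obtain ⟨c, hc⟩ := ih _ (Subgroup.mem_upperCentralSeries_succ_iff.1 hh y)
        have hmul : ρ (1, h) * ρ (1, y) = c • (ρ (1, y) * ρ (1, h)) := by
          rw [← one_mul (ρ (1, y) * ρ (1, h)), ← smul_mul_assoc, ← hc, ← map_mul, ← map_mul,
            ← map_mul]
          simp [commutatorElement_def]
        have hcp : c ^ p ^ α = 1 :=
          hα ▸ LinearMap.pow_finrank_eq_one_of_mul_eq_smul_mul (hunit _) (hunit _) hmul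
        obtain ⟨k, hk⟩ := hH (h * y * h⁻¹ * y⁻¹)
        have hcq : c ^ q ^ k = 1 := by
          have := congrArg (· ^ q ^ k) hc
          simp only [← map_pow, Prod.pow_mk, one_pow, commutatorElement_def, hk, smul_pow] at this
          have h1 : (1 : Module.End K P) = c ^ q ^ k • 1 := (map_one ρ).symm.trans this
          obtain ⟨x, hx⟩ := exists_ne (0 : P)
          refine smul_left_injective K hx ?_
          simpa using (LinearMap.congr_fun h1 x).symm
        have hc1 : c = 1 := by
          have := pow_gcd_eq_one.2 ⟨hcp, hcq⟩
          rwa [((Nat.coprime_primes hp hq).2 hpq).pow α k, pow_one] at this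
        rw [hmul, hc1, one_smul]
      obtain ⟨c, hc⟩ := MonoidAlgebra.exists_eq_smul_of_isSimpleModule (ρ (1, h)) fun g x => by
        have hg : ρ (1, h) * ρ g = ρ g * ρ (1, h) := by
          have hg' : ρ g = ρ (g.1, 1) * ρ (1, g.2) := by simp [← map_mul]
          have hG' : ρ (1, h) * ρ (g.1, 1) = ρ (g.1, 1) * ρ (1, h) := by simp [← map_mul]
          rw [hg', ← mul_assoc, hG', mul_assoc, hcomm, mul_assoc]
        exact LinearMap.congr_fun hg x
      exact ⟨c, LinearMap.ext hc⟩
  obtain ⟨n, hn⟩ := Group.IsNilpotent.nilpotent H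
  choose c hc using fun h : H => key n h (hn ▸ Subgroup.mem_top h)
  have hinj : Function.Injective fun a : K => a • (1 : Module.End K P) :=
    smul_left_injective K one_ne_zero
  let χ : H →* K :=
    { toFun := c
      map_one' := hinj <| by
        simp only [← hc, one_smul]
        exact map_one ρ
      map_mul' := fun x y => hinj <| by
        have h1 : ρ (1, x * y) = ρ (1, x) * ρ (1, y) := by simp [← map_mul]
        simp only [← hc, h1]
        rw [hc, hc, smul_mul_smul_comm, one_mul] }
  exact ⟨χ.toHomUnits, fun h x => LinearMap.congr_fun (hc h) x⟩
end
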